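/- arXiv:2310.00793 — 3 statements merged into one kernel-verified Lean document; each statement's English description precedes it below -/
import Mathlib

section
/- Let x, y ∈ ℝ^D with d = dist(x, y) and r₁, r₂ ≥ 0, and suppose closedBall(x, r₁) ∩ closedBall(y, r₂) is nonempty. Then volume(closedBall(x, r₁) ∩ closedBall(y, r₂)) ≤ (max(r₁, r₂)² − (d/2)²)^{D/2} · V(1). -/
open MeasureTheory Metric

/-- In `ℝ^D` (`D ≥ 1`), if the intersection
`closedBall x r₁ ∩ closedBall y r₂` is nonempty (`r₁, r₂ ≥ 0`), then its volume
is at most `(max(r₁, r₂)² - (d/2)²)^(D/2) * V(1)`, where `d = dist x y` and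
`V(1)` is the volume of a closed unit ball. -/
theorem stmt2 {D : ℕ} (hD : 1 ≤ D) (x y : EuclideanSpace ℝ (Fin D))
    (d : ℝ) (hd : d = dist x y) (r₁ r₂ : ℝ) (hr₁ : 0 ≤ r₁) (hr₂ : 0 ≤ r₂)
    (hne : (closedBall x r₁ ∩ closedBall y r₂).Nonempty) :
    volume (closedBall x r₁ ∩ closedBall y r₂) ≤
      ENNReal.ofReal ((max r₁ r₂ ^ 2 - (d / 2) ^ 2) ^ ((D : ℝ) / 2)) *
        volume (closedBall (0 : EuclideanSpace ℝ (Fin D)) 1) := by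
  set R := max r₁ r₂ with hR
  have hR0 : 0 ≤ R := le_trans hr₁ (le_max_left _ _)
  have key : ∀ z ∈ closedBall x r₁ ∩ closedBall y r₂,
      dist z (midpoint ℝ x y) ^ 2 ≤ R ^ 2 - (d / 2) ^ 2 := by
    rintro z ⟨h1, h2⟩
    rw [mem_closedBall] at h1 h2
    have h1' : dist z x ≤ R := h1.trans (le_max_left _ _)
    have h2' : dist z y ≤ R := h2.trans (le_max_right _ _)
    have hp := parallelogram_law_with_norm ℝ (z - x) (z - y)
    have e1 : (z - x) + (z - y) = (2 : ℝ) • (z - midpoint ℝ x y) := by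
      rw [midpoint_eq_smul_add, smul_sub, smul_smul]
      norm_num
      rw [two_smul]
      abel
    have e2 : (z - x) - (z - y) = -(x - y) := by abel
    rw [e1, e2, norm_neg, norm_smul, ← dist_eq_norm, ← dist_eq_norm, ← dist_eq_norm,
      ← dist_eq_norm, ← hd] at hp
    norm_num at hp
    have a1 : dist z x ^ 2 ≤ R ^ 2 := pow_le_pow_left₀ dist_nonneg h1' 2
    have a2 : dist z y ^ 2 ≤ R ^ 2 := pow_le_pow_left₀ dist_nonneg h2' 2
    nlinarith
  have hnn : 0 ≤ R ^ 2 - (d / 2) ^ 2 := by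
    obtain ⟨z, hz⟩ := hne
    exact (sq_nonneg _).trans (key z hz)
  have hsub : closedBall x r₁ ∩ closedBall y r₂ ⊆
      closedBall (midpoint ℝ x y) (Real.sqrt (R ^ 2 - (d / 2) ^ 2)) := fun z hz =>
    mem_closedBall.2 (Real.le_sqrt_of_sq_le (key z hz))
  refine (measure_mono hsub).trans (le_of_eq ?_)
  rw [Measure.addHaar_closedBall' _ _ (Real.sqrt_nonneg _), finrank_euclideanSpace_fin,
    Real.sqrt_eq_rpow, ← Real.rpow_natCast, ← Real.rpow_mul hnn]
  congr 3
  ring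
end

section
/- For fixed radii r₁, r₂ ≥ 0, the volume of the intersection of two closed balls in ℝ^D is a nonincreasing function of the distance between their centers: if x, y, x', y' ∈ ℝ^D satisfy dist(x, y) ≤ dist(x', y'), then volume(closedBall(x', r₁) ∩ closedBall(y', r₂)) ≤ volume(closedBall(x, r₁) ∩ closedBall(y, r₂)). -/
open MeasureTheory Metric

theorem aux_refl {D : ℕ} (r₁ r₂ : ℝ) (x v : EuclideanSpace ℝ (Fin D))
    (h : dist x (-v) ≤ dist x v) :
    volume (closedBall x r₁ ∩ closedBall v r₂) ≤
      volume (closedBall x r₁ ∩ closedBall (-v) r₂) := by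
  set σ := (Submodule.span ℝ {v})ᗮ.reflection with hσ
  have hv : σ v = -v := Submodule.reflection_orthogonalComplement_singleton_eq_neg v
  have hv' : σ (-v) = v := by rw [map_neg, hv, neg_neg]
  have hxv : inner ℝ x v ≤ 0 := by
    rw [dist_eq_norm, dist_eq_norm, sub_neg_eq_add] at h
    have h2 := pow_le_pow_left₀ (norm_nonneg _) h 2
    rw [norm_add_sq_real, norm_sub_sq_real] at h2
    linarith
  have hP : MeasurableSet (closedBall x r₁ ∩ closedBall v r₂) :=
    measurableSet_closedBall.inter measurableSet_closedBall
  have hQ : MeasurableSet (closedBall x r₁ ∩ closedBall (-v) r₂) :=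
    measurableSet_closedBall.inter measurableSet_closedBall
  have key : (closedBall x r₁ ∩ closedBall v r₂) \ (closedBall x r₁ ∩ closedBall (-v) r₂) ⊆
      σ ⁻¹' ((closedBall x r₁ ∩ closedBall (-v) r₂) \ (closedBall x r₁ ∩ closedBall v r₂)) := by
    rintro z ⟨⟨hz1, hz2⟩, hz3⟩
    have hz4 : ¬ dist z (-v) ≤ r₂ := fun h4 => hz3 ⟨hz1, h4⟩
    rw [mem_closedBall] at hz1 hz2
    have e1 : dist (σ z) (-v) = dist z v := by rw [← hv, σ.dist_map]
    have e2 : dist (σ z) v = dist z (-v) := by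
      conv_lhs => rw [← hv']
      rw [σ.dist_map]
    have hzv : 0 < inner ℝ z v := by
      have h1 : dist z v < dist z (-v) := by linarith
      rw [dist_eq_norm, dist_eq_norm, sub_neg_eq_add] at h1
      have h2 := pow_lt_pow_left₀ h1 (norm_nonneg _) two_ne_zero
      rw [norm_add_sq_real, norm_sub_sq_real] at h2
      linarith
    have e3 : dist (σ z) x ≤ dist z x := by
      rw [dist_eq_norm, dist_eq_norm]
      refine (sq_le_sq₀ (norm_nonneg _) (norm_nonneg _)).1 ?_
      rw [norm_sub_sq_real, norm_sub_sq_real, σ.norm_map]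
      have : σ z = z - (2 * (inner ℝ v z / ‖v‖ ^ 2)) • v := by
        rw [hσ, Submodule.reflection_orthogonal_apply, Submodule.reflection_singleton_apply]
        simp [smul_smul, two_smul, two_mul, add_smul]
      rw [this, inner_sub_left, real_inner_smul_left, real_inner_comm z v, real_inner_comm x v]
      have : (2 * (inner ℝ z v / ‖v‖ ^ 2)) * inner ℝ x v ≤ 0 :=
        mul_nonpos_of_nonneg_of_nonpos (by positivity) hxv
      linarith
    refine ⟨⟨?_, ?_⟩, fun h5 => hz4 ?_⟩
    · exact e3.trans hz1
    · exact e1.le.trans hz2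
    · rw [← e2]; exact h5.2
  rw [← measure_inter_add_sdiff (closedBall x r₁ ∩ closedBall v r₂) hQ,
    ← measure_inter_add_sdiff (closedBall x r₁ ∩ closedBall (-v) r₂) hP,
    Set.inter_comm (closedBall x r₁ ∩ closedBall v r₂)]
  gcongr 1
  refine (measure_mono key).trans_eq ?_
  exact σ.measurePreserving.measure_preimage (hQ.diff hP).nullMeasurableSet

theorem aux_trans {D : ℕ} (r₁ r₂ : ℝ) (x y c : EuclideanSpace ℝ (Fin D)) :
    volume (closedBall (x - c) r₁ ∩ closedBall (y - c) r₂) =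
      volume (closedBall x r₁ ∩ closedBall y r₂) := by
  rw [← measure_preimage_add_right volume c (closedBall x r₁ ∩ closedBall y r₂)]
  congr 1
  ext z
  simp [dist_eq_norm, sub_sub_eq_add_sub]

/-- In `ℝ^D` (`D ≥ 1`), for fixed radii `r₁, r₂ ≥ 0`, the
volume of the intersection of two closed balls is a nonincreasing function of
the distance between their centers. -/
theorem stmt3 {D : ℕ} (hD : 1 ≤ D) (r₁ r₂ : ℝ) (hr₁ : 0 ≤ r₁) (hr₂ : 0 ≤ r₂)
    (x y x' y' : EuclideanSpace ℝ (Fin D)) (h : dist x y ≤ dist x' y') :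
    volume (closedBall x' r₁ ∩ closedBall y' r₂) ≤
      volume (closedBall x r₁ ∩ closedBall y r₂) := by
  obtain ⟨w, hw⟩ : ∃ w, w = y' - (x' - x) := ⟨_, rfl⟩
  obtain ⟨m, hm⟩ : ∃ m, m = (1 / 2 : ℝ) • (y + w) := ⟨_, rfl⟩
  rw [← aux_trans r₁ r₂ x' y' (x' - x), sub_sub_cancel, ← hw,
    ← aux_trans r₁ r₂ x w m, ← aux_trans r₁ r₂ x y m]
  have hy : y - m = -(w - m) := by rw [hm]; module
  rw [hy]
  apply aux_refl
  rw [← hy, dist_sub_right, dist_sub_right]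
  refine h.trans_eq ?_
  rw [hw, dist_eq_norm, dist_eq_norm]
  congr 1
  abel
end

section
/- Let G and G' be simple graphs on the same finite vertex set that differ only in edges incident to a single vertex p, i.e. for all vertices u, v with u ≠ p and v ≠ p, u and v are adjacent in G if and only if they are adjacent in G'. Suppose every vertex degree in G and in G' is at most Δ. Then for every integer ℓ ≥ 2 and all vertices i, j with i ≠ p and j ≠ p, the numbers of length-ℓ walks from i to j in G and in G' differ by at most (ℓ−1)·Δ^{ℓ−2}. -/
open SimpleGraph

theorem walk_bound {V : Type*} [Fintype V] [DecidableEq V]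
    (G : SimpleGraph V) [DecidableRel G.Adj] (Δ : ℕ) (hΔ : ∀ v : V, G.degree v ≤ Δ)
    (m : ℕ) (i j : V) : (G.adjMatrix ℕ ^ (m + 1)) i j ≤ Δ ^ m := by
  induction m generalizing i with
  | zero => simp only [zero_add, pow_one, pow_zero, adjMatrix_apply]; split_ifs <;> simp
  | succ m ih =>
    rw [pow_succ', Matrix.mul_apply]
    calc _ ≤ ∑ u, G.adjMatrix ℕ i u * Δ ^ m :=
          Finset.sum_le_sum fun u _ => Nat.mul_le_mul_left _ (ih u)
      _ = G.degree i * Δ ^ m := by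
          rw [← Finset.sum_mul]; congr 1
          simp [adjMatrix_apply, ← G.card_neighborFinset_eq_degree, neighborFinset_eq_filter]
      _ ≤ Δ ^ (m + 1) := by
          rw [pow_succ']; exact Nat.mul_le_mul_right _ (hΔ i)

/-- adjacency matrix with row and column `p` zeroed -/
def cutMatrix {V : Type*} [DecidableEq V]
    (G : SimpleGraph V) [DecidableRel G.Adj] (p : V) : Matrix V V ℕ :=
  fun u v => if u = p ∨ v = p then 0 else G.adjMatrix ℕ u v

theorem cut_lower {V : Type*} [Fintype V] [DecidableEq V]
    (G : SimpleGraph V) [DecidableRel G.Adj] (p : V) (m : ℕ) (i j : V) :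
    (cutMatrix G p ^ m) i j ≤ (G.adjMatrix ℕ ^ m) i j := by
  induction m generalizing i with
  | zero => simp
  | succ m ih =>
    rw [pow_succ', pow_succ', Matrix.mul_apply, Matrix.mul_apply]
    refine Finset.sum_le_sum fun u _ => Nat.mul_le_mul ?_ (ih u)
    unfold cutMatrix
    split_ifs <;> simp

theorem cut_upper {V : Type*} [Fintype V] [DecidableEq V]
    (G : SimpleGraph V) [DecidableRel G.Adj] (p : V) (Δ : ℕ) (hΔ : ∀ v : V, G.degree v ≤ Δ)
    (m : ℕ) (i j : V) (hi : i ≠ p) (hj : j ≠ p) :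
    (G.adjMatrix ℕ ^ (m + 1)) i j ≤ (cutMatrix G p ^ (m + 1)) i j + m * Δ ^ (m - 1) := by
  induction m generalizing i with
  | zero => simp [cutMatrix, hi, hj]
  | succ m ih =>
    rw [pow_succ', pow_succ' (cutMatrix G p), Matrix.mul_apply, Matrix.mul_apply]
    calc _ ≤ ∑ u, (cutMatrix G p i u * (cutMatrix G p ^ (m + 1)) u j
            + G.adjMatrix ℕ i u * (m * Δ ^ (m - 1)) + if u = p then Δ ^ m else 0) := by
          refine Finset.sum_le_sum fun u _ => ?_
          by_cases hu : u = p
          · have h1 := walk_bound G Δ hΔ m u j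
            have h2 : G.adjMatrix ℕ i u ≤ 1 := by
              rw [adjMatrix_apply]; split_ifs <;> simp
            have h3 := Nat.mul_le_mul h2 h1
            rw [if_pos hu]
            omega
          · have h1 := Nat.mul_le_mul_left (G.adjMatrix ℕ i u) (ih u hu)
            have h2 : cutMatrix G p i u = G.adjMatrix ℕ i u := by simp [cutMatrix, hi, hu]
            rw [if_neg hu, h2, ← mul_add]
            exact h1
      _ = ∑ u, cutMatrix G p i u * (cutMatrix G p ^ (m + 1)) u j
            + G.degree i * (m * Δ ^ (m - 1)) + Δ ^ m := by
          rw [Finset.sum_add_distrib, Finset.sum_add_distrib, ← Finset.sum_mul]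
          congr 1
          · congr 2
            simp [adjMatrix_apply, ← G.card_neighborFinset_eq_degree, neighborFinset_eq_filter]
          · simp
      _ ≤ _ := by
          have h1 : G.degree i * (m * Δ ^ (m - 1)) ≤ Δ * (m * Δ ^ (m - 1)) :=
            Nat.mul_le_mul_right _ (hΔ i)
          have h2 : Δ * (m * Δ ^ (m - 1)) = m * Δ ^ m := by
            cases m with
            | zero => simp
            | succ k => simp only [Nat.add_sub_cancel]; ring
          rw [Nat.add_sub_cancel, add_mul, one_mul]
          omega

/-- If two simple graphs `G`, `G'` on the same finite vertex
set differ only in edges incident to a single vertex `p`, and every vertex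
degree in both graphs is at most `Δ`, then for every `ℓ ≥ 2` and all vertices
`i ≠ p`, `j ≠ p`, the numbers of length-`ℓ` walks from `i` to `j` in `G` and
`G'` (the `(i,j)` entries of the `ℓ`-th powers of the adjacency matrices)
differ by at most `(ℓ-1)·Δ^{ℓ-2}`. -/
theorem stmt7 {V : Type*} [Fintype V] [DecidableEq V]
    (G G' : SimpleGraph V) [DecidableRel G.Adj] [DecidableRel G'.Adj]
    (p : V) (hp : ∀ u v : V, u ≠ p → v ≠ p → (G.Adj u v ↔ G'.Adj u v))
    (Δ : ℕ) (hΔ : ∀ v : V, G.degree v ≤ Δ) (hΔ' : ∀ v : V, G'.degree v ≤ Δ)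
    (ℓ : ℕ) (hℓ : 2 ≤ ℓ) (i j : V) (hi : i ≠ p) (hj : j ≠ p) :
    |((G.adjMatrix ℕ ^ ℓ) i j : ℤ) - ((G'.adjMatrix ℕ ^ ℓ) i j : ℤ)| ≤
      (ℓ - 1 : ℕ) * (Δ : ℤ) ^ (ℓ - 2) := by
  have hc : cutMatrix G p = cutMatrix G' p := by
    funext u v
    unfold cutMatrix
    split_ifs with h
    · rfl
    · push Not at h
      simp [adjMatrix_apply, hp u v h.1 h.2]
  obtain ⟨m, rfl⟩ : ∃ m, ℓ = m + 1 := ⟨ℓ - 1, by omega⟩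
  have a1 := cut_lower G p (m + 1) i j
  have a2 := cut_upper G p Δ hΔ m i j hi hj
  have b1 := cut_lower G' p (m + 1) i j
  have b2 := cut_upper G' p Δ hΔ' m i j hi hj
  rw [hc] at a1 a2
  rw [Nat.add_sub_cancel, show m + 1 - 2 = m - 1 by omega]
  zify at a1 a2 b1 b2
  rw [abs_le]
  constructor <;> linarith
end
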